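/- arXiv:2412.10221 — 2 statements merged into one kernel-verified Lean document; each statement's English description precedes it below -/
import Mathlib

section
/- Let {E_α : α ∈ A} be an arbitrary family of real Banach spaces. Then the product Y = ∏_{α∈A} E_α, with the product topology, is an Asplund locally convex space if and only if every E_α is an Asplund space. -/
open Filter Topology Bornology TopologicalSpace

section Definitions

variable {E : Type*} [AddCommGroup E] [Module ℝ E] [TopologicalSpace E]

/-- A function `f` (thought of as a convex function on an open convex set containing `x₀`)
is Gâteaux differentiable at `x₀` if there is a continuous linear functional `L` such that
for every direction `x` and every `ε > 0` there is `δ > 0` with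
`|(f (x₀ + t • x) - f x₀) / t - L x| < ε` whenever `0 < |t| < δ`. -/
def GateauxDiffAt (f : E → ℝ) (x₀ : E) : Prop :=
  ∃ L : E →L[ℝ] ℝ, ∀ x : E, ∀ ε : ℝ, 0 < ε → ∃ δ : ℝ, 0 < δ ∧ ∀ t : ℝ,
    0 < |t| → |t| < δ → |(f (x₀ + t • x) - f x₀) / t - L x| < ε

/-- A function `f` is Fréchet differentiable at `x₀` if there is a continuous linear
functional `L` such that for every (von Neumann) bounded set `B` and every `ε > 0` there is
`δ > 0` with `|(f (x₀ + t • x) - f x₀) / t - L x| < ε` for all `x ∈ B`, whenever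
`0 < |t| < δ`. -/
def FrechetDiffAt (f : E → ℝ) (x₀ : E) : Prop :=
  ∃ L : E →L[ℝ] ℝ, ∀ B : Set E, IsVonNBounded ℝ B → ∀ ε : ℝ, 0 < ε →
    ∃ δ : ℝ, 0 < δ ∧ ∀ t : ℝ, 0 < |t| → |t| < δ →
      ∀ x ∈ B, |(f (x₀ + t • x) - f x₀) / t - L x| < ε

end Definitions

/-- `E` is Asplund: every continuous convex function on a nonempty open convex set `D`
is Fréchet differentiable at every point of a set which is a dense `Gδ` subset of `D`. -/
def IsAsplund (E : Type*) [AddCommGroup E] [Module ℝ E] [TopologicalSpace E] : Prop :=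
  ∀ (D : Set E) (f : E → ℝ), D.Nonempty → IsOpen D → Convex ℝ D →
    ContinuousOn f D → ConvexOn ℝ D f →
    ∃ G : Set E, G ⊆ D ∧ IsGδ (Subtype.val ⁻¹' G : Set D) ∧
      Dense (Subtype.val ⁻¹' G : Set D) ∧ ∀ x ∈ G, FrechetDiffAt f x

section Aux

/-- Points of `D` at which the second difference of `f` in the directions of the range of `T`
is eventually smaller than `ε`. -/
def smallOsc {V X : Type*} [NormedAddCommGroup V] [NormedSpace ℝ V] [NormedAddCommGroup X]
    [NormedSpace ℝ X] (D : Set X) (f : X → ℝ) (T : V →L[ℝ] X) (ε : ℝ) : Set X :=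
  {x | ∃ r > 0, ∃ K : NNReal, Metric.ball x r ⊆ D ∧ LipschitzOnWith K f (Metric.ball x r) ∧
    ∃ δ > 0, ∃ c < ε, δ * ‖T‖ < r ∧
      ∀ u : V, ‖u‖ ≤ 1 → f (x + δ • T u) + f (x - δ • T u) - 2 * f x ≤ c * δ}

variable {V X : Type*} [NormedAddCommGroup V] [NormedSpace ℝ V] [NormedAddCommGroup X]
    [NormedSpace ℝ X] {D : Set X} {f : X → ℝ} {T : V →L[ℝ] X}

lemma norm_smul_T_le {δ : ℝ} (hδ : 0 < δ) {u : V} (hu : ‖u‖ ≤ 1) : ‖δ • T u‖ ≤ δ * ‖T‖ := by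
  rw [norm_smul, Real.norm_of_nonneg hδ.le]
  gcongr
  calc ‖T u‖ ≤ ‖T‖ * ‖u‖ := T.le_opNorm u
    _ ≤ ‖T‖ * 1 := by gcongr
    _ = ‖T‖ := mul_one _

lemma smallOsc_subset {ε : ℝ} : smallOsc D f T ε ⊆ D := by
  rintro x ⟨r, hr, K, hD, -⟩
  exact hD (Metric.mem_ball_self hr)

lemma isOpen_smallOsc {ε : ℝ} : IsOpen (smallOsc D f T ε) := by
  rw [Metric.isOpen_iff]
  rintro x ⟨r, hr, K, hD, hL, δ, hδ, c, hc, hTr, H⟩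
  obtain ⟨η, hη, hη1, hη2⟩ : ∃ η > 0, δ * ‖T‖ < r - η ∧ 4 * K * η ≤ (ε - c) / 2 * δ := by
    have h1 : 0 < (r - δ * ‖T‖) / 2 := by linarith
    have h2 : 0 < (ε - c) / 2 * δ := mul_pos (by linarith) hδ
    have hK : (0 : ℝ) ≤ K := K.2
    have h3 : 0 < (ε - c) / 2 * δ / (4 * K + 1) := by positivity
    refine ⟨min ((r - δ * ‖T‖) / 2) ((ε - c) / 2 * δ / (4 * K + 1)), lt_min h1 h3, ?_, ?_⟩
    · have := min_le_left ((r - δ * ‖T‖) / 2) ((ε - c) / 2 * δ / (4 * K + 1))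
      linarith
    · have := min_le_right ((r - δ * ‖T‖) / 2) ((ε - c) / 2 * δ / (4 * K + 1))
      rw [le_div_iff₀ (by positivity)] at this
      have h0 := (lt_min h1 h3).le
      nlinarith
  refine ⟨η, hη, fun y hy => ?_⟩
  have hδT : 0 ≤ δ * ‖T‖ := by positivity
  have hyx : dist y x < η := hy
  have hsub : Metric.ball y (r - η) ⊆ Metric.ball x r := Metric.ball_subset_ball' (by linarith)
  refine ⟨r - η, by linarith, K, hsub.trans hD, hL.mono hsub, δ, hδ, (c + ε) / 2, by linarith,
    hη1, fun u hu => ?_⟩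
  have hn := norm_smul_T_le (T := T) hδ hu
  have key : ∀ w : X, ‖w‖ ≤ δ * ‖T‖ → |f (y + w) - f (x + w)| ≤ K * η := by
    intro w hw
    have h1 : y + w ∈ Metric.ball x r := hsub (by simp [Metric.mem_ball, dist_eq_norm]; linarith)
    have h2 : x + w ∈ Metric.ball x r := by simp [Metric.mem_ball, dist_eq_norm]; linarith
    have := hL.dist_le_mul _ h1 _ h2
    rw [Real.dist_eq, dist_add_right] at this
    exact this.trans (by gcongr)
  have k1 := abs_le.1 (key _ hn)
  have k2 := abs_le.1 (key (-(δ • T u)) (by rwa [norm_neg]))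
  have k3 := abs_le.1 (key 0 (by simpa using hδT))
  simp only [← sub_eq_add_neg, add_zero] at k1 k2 k3
  have := H u hu
  nlinarith [k1.1, k1.2, k2.1, k2.2, k3.1, k3.2]

lemma mem_smallOsc_of_frechet (hD : IsOpen D) (hf : LocallyLipschitzOn D f) {x : X} (hx : x ∈ D)
    (h : FrechetDiffAt (fun v => f (x + T v)) 0) {ε : ℝ} (hε : 0 < ε) :
    x ∈ smallOsc D f T ε := by
  obtain ⟨K, t, ht, hL⟩ := hf hx
  rw [hD.nhdsWithin_eq hx] at ht
  obtain ⟨r, hr, hrs⟩ := Metric.mem_nhds_iff.1 (inter_mem ht (hD.mem_nhds hx))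
  obtain ⟨L, hL'⟩ := h
  obtain ⟨δ, hδ, H⟩ := hL' (Metric.closedBall 0 1) (NormedSpace.isVonNBounded_closedBall ℝ V 1)
    (ε / 4) (by linarith)
  obtain ⟨d, hd, hd1, hd2⟩ : ∃ d > 0, d < δ ∧ d * ‖T‖ < r := by
    have h3 : 0 < r / (‖T‖ + 1) := by positivity
    refine ⟨min (δ / 2) (r / (‖T‖ + 1)), lt_min (by linarith) h3, ?_, ?_⟩
    · exact (min_le_left _ _).trans_lt (by linarith)
    · have := min_le_right (δ / 2) (r / (‖T‖ + 1))
      rw [le_div_iff₀ (by positivity)] at this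
      have : 0 < min (δ / 2) (r / (‖T‖ + 1)) := lt_min (by linarith) h3
      linarith
  refine ⟨r, hr, K, fun z hz => (hrs hz).2, hL.mono fun z hz => (hrs hz).1, d, hd, ε / 2,
    by linarith, hd2, fun u hu => ?_⟩
  have h1 := H d (by positivity) (by rwa [abs_of_pos hd]) u (by simpa using hu)
  have h2 := H (-d) (by simpa using hd.ne') (by rwa [abs_neg, abs_of_pos hd]) u (by simpa using hu)
  simp only [zero_add, map_smul, map_zero, add_zero, neg_smul, map_neg] at h1 h2
  rw [← sub_eq_add_neg] at h2
  have e1 := (abs_lt.1 h1).2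
  have e2 := (abs_lt.1 h2).1
  rw [sub_lt_iff_lt_add, div_lt_iff₀ hd] at e1
  rw [div_neg, lt_sub_iff_add_lt, lt_neg, div_lt_iff₀ hd] at e2
  nlinarith

lemma smallOsc_mono (hf : ConvexOn ℝ D f) {ε : ℝ} {x : X} (hx : x ∈ smallOsc D f T ε) :
    ∃ δ > 0, ∀ s, 0 < s → s ≤ δ → ∀ v : V, ‖v‖ ≤ s → x + T v ∈ D ∧ x - T v ∈ D ∧
      f (x + T v) + f (x - T v) - 2 * f x ≤ ε * s := by
  obtain ⟨r, hr, K, hD, hL, δ, hδ, c, hc, hTr, H⟩ := hx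
  refine ⟨δ, hδ, fun s hs hsδ v hv => ?_⟩
  have hxD : x ∈ D := hD (Metric.mem_ball_self hr)
  set u : V := s⁻¹ • v with hu
  have hun : ‖u‖ ≤ 1 := by
    rw [hu, norm_smul, norm_inv, Real.norm_of_nonneg hs.le, inv_mul_le_iff₀ hs]; simpa using hv
  have hn := norm_smul_T_le (T := T) hδ hun
  have hp : x + δ • T u ∈ D := hD (by simp [Metric.mem_ball]; linarith)
  have hm : x - δ • T u ∈ D := hD (by simp [Metric.mem_ball, dist_eq_norm]; linarith)
  have hl0 : 0 ≤ s / δ := by positivity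
  have hl1 : 0 ≤ 1 - s / δ := by rw [sub_nonneg, div_le_one hδ]; exact hsδ
  have ev : T v = (s / δ) • (δ • T u) := by
    rw [hu, map_smul, smul_smul, smul_smul]
    have : s / δ * δ * s⁻¹ = 1 := by field_simp
    rw [mul_assoc] at this
    simp [← mul_assoc, mul_assoc (s / δ), this]
  have e1 : x + T v = (1 - s / δ) • x + (s / δ) • (x + δ • T u) := by rw [ev]; module
  have e2 : x - T v = (1 - s / δ) • x + (s / δ) • (x - δ • T u) := by rw [ev]; module
  refine ⟨e1 ▸ hf.1 hxD hp hl1 hl0 (by ring), e2 ▸ hf.1 hxD hm hl1 hl0 (by ring), ?_⟩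
  have i1 := hf.2 hxD hp hl1 hl0 (by ring)
  have i2 := hf.2 hxD hm hl1 hl0 (by ring)
  rw [← e1] at i1
  rw [← e2] at i2
  simp only [smul_eq_mul] at i1 i2
  have i3 := mul_le_mul_of_nonneg_left (H u hun) hl0
  have i4 : s / δ * (c * δ) = c * s := by field_simp
  nlinarith

lemma exists_subgradient (hD : IsOpen D) (hc : ContinuousOn f D) (hf : ConvexOn ℝ D f) {x : X}
    (hx : x ∈ D) : ∃ L : X →L[ℝ] ℝ, ∀ y ∈ D, f x + L (y - x) ≤ f y := by
  have hopen : IsOpen {p : X × ℝ | p.1 ∈ D ∧ f p.1 < p.2} := by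
    have h1 : IsOpen (Prod.fst ⁻¹' D : Set (X × ℝ)) := hD.preimage continuous_fst
    have h2 : ContinuousOn (fun p : X × ℝ => p.2 - f p.1) (Prod.fst ⁻¹' D) :=
      continuousOn_snd.sub (hc.comp continuousOn_fst fun p hp => hp)
    have h3 := h2.isOpen_inter_preimage h1 (isOpen_Ioi (a := (0 : ℝ)))
    convert h3 using 1
    ext p; simp
  obtain ⟨φ, hφ⟩ := geometric_hahn_banach_point_open (x := (x, f x)) hf.convex_strict_epigraph
    hopen (by simp)
  have dec : ∀ y s, φ (y, s) = φ (y, 0) + s * φ (0, 1) := by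
    intro y s
    have : ((y, s) : X × ℝ) = (y, 0) + s • (0, 1) := by simp
    rw [this, map_add, map_smul, smul_eq_mul]
  have ha : 0 < φ (0, 1) := by
    have := hφ (x, f x + 1) ⟨hx, by simp⟩
    rw [dec x (f x), dec x (f x + 1)] at this
    linarith
  refine ⟨-(φ (0, 1))⁻¹ • φ.comp (ContinuousLinearMap.inl ℝ X ℝ), fun y hy => ?_⟩
  refine le_of_forall_pos_lt_add fun e he => ?_
  have h1 := hφ (y, f y + e) ⟨hy, by simpa using he⟩
  rw [dec x (f x), dec y (f y + e)] at h1
  have h2 : φ (y - x, 0) = φ (y, 0) - φ (x, 0) := by rw [← map_sub]; simp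
  simp only [smul_apply, ContinuousLinearMap.comp_apply,
    ContinuousLinearMap.inl_apply, h2, smul_eq_mul]
  have h3 : (φ (0, 1))⁻¹ * φ (0, 1) = 1 := inv_mul_cancel₀ ha.ne'
  have h4 := mul_lt_mul_of_pos_left h1 (inv_pos.2 ha)
  have h5 : ∀ s, (φ (0, 1))⁻¹ * (s * φ (0, 1)) = s := fun s => by field_simp
  rw [mul_add, mul_add, h5, h5] at h4
  linarith

lemma frechet_of_smallOsc {ι : Type*} [Fintype ι] {W : ι → Type*}
    [∀ i, NormedAddCommGroup (W i)] [∀ i, NormedSpace ℝ (W i)]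
    (S : ∀ i, W i →L[ℝ] X) (p : ∀ i, X → W i) (hp : ∀ i h, ‖p i h‖ ≤ ‖h‖)
    (hS : ∀ h, ∑ i, S i (p i h) = h)
    (hD : IsOpen D) (hc : ContinuousOn f D) (hf : ConvexOn ℝ D f) {x : X} (hx : x ∈ D)
    (H : ∀ i, ∀ ε > 0, x ∈ smallOsc D f (S i) ε) : FrechetDiffAt f x := by
  obtain ⟨L, hL⟩ := exists_subgradient hD hc hf hx
  refine ⟨L, fun B hB ε hε => ?_⟩
  obtain ⟨R, hR, hBR⟩ : ∃ R > 0, ∀ b ∈ B, ‖b‖ ≤ R := by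
    have := (NormedSpace.isVonNBounded_iff ℝ).1 hB
    obtain ⟨R, hR, h⟩ := this.exists_pos_norm_le
    exact ⟨R, hR, h⟩
  rcases isEmpty_or_nonempty ι with hι | hι
  · have h0 : ∀ h : X, h = 0 := fun h => by rw [← hS h]; simp
    refine ⟨1, one_pos, fun t _ _ b _ => ?_⟩
    rw [h0 b]; simpa using hε
  set n : ℝ := (Fintype.card ι : ℝ) with hn
  have hn0 : 0 < n := by rw [hn]; exact_mod_cast Fintype.card_pos
  have hε' : 0 < ε / (2 * n * R) := by positivity
  choose δ hδ Hδ using fun i => smallOsc_mono hf (H i _ hε')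
  obtain ⟨d, hd, hdi⟩ : ∃ d > 0, ∀ i, d ≤ δ i := by
    refine ⟨Finset.univ.inf' Finset.univ_nonempty δ, ?_, fun i => Finset.inf'_le _ (by simp)⟩
    simpa [Finset.lt_inf'_iff] using hδ
  refine ⟨d / (n * R), by positivity, fun t ht htd b hb => ?_⟩
  set h : X := t • b with hh
  set s : ℝ := |t| * (n * R) with hs
  have hs0 : 0 < s := by positivity
  have hsd : s ≤ d := by rw [lt_div_iff₀ (by positivity)] at htd; exact htd.le
  have hnp : ∀ i, ‖n • p i h‖ ≤ s := fun i => by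
    rw [norm_smul, Real.norm_of_nonneg hn0.le, hs]
    have := hp i h
    rw [hh, norm_smul, Real.norm_eq_abs, ← hh] at this
    have := this.trans (mul_le_mul_of_nonneg_left (hBR b hb) (abs_nonneg t))
    nlinarith
  have Q := fun i => Hδ i s hs0 (hsd.trans (hdi i)) _ (hnp i)
  have hw : ∑ i : ι, n⁻¹ = 1 := by
    simp only [Finset.sum_const, Finset.card_univ, nsmul_eq_mul, ← hn]
    field_simp
  have hcx : ∑ i : ι, n⁻¹ • x = x := by rw [← Finset.sum_smul, hw, one_smul]
  have hch : ∑ i : ι, n⁻¹ • S i (n • p i h) = h := by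
    conv_rhs => rw [← hS h]
    refine Finset.sum_congr rfl fun i _ => ?_
    rw [map_smul, smul_smul, inv_mul_cancel₀ hn0.ne', one_smul]
  have ep : ∑ i, n⁻¹ • (x + S i (n • p i h)) = x + h := by
    simp only [smul_add, Finset.sum_add_distrib, hcx, hch]
  have em : ∑ i, n⁻¹ • (x - S i (n • p i h)) = x - h := by
    simp only [smul_sub, Finset.sum_sub_distrib, hcx, hch]
  have jp := hf.map_sum_le (t := Finset.univ) (w := fun _ => n⁻¹)
    (p := fun i => x + S i (n • p i h)) (fun _ _ => by positivity) hw (fun i _ => (Q i).1)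
  have jm := hf.map_sum_le (t := Finset.univ) (w := fun _ => n⁻¹)
    (p := fun i => x - S i (n • p i h)) (fun _ _ => by positivity) hw (fun i _ => (Q i).2.1)
  have mp := hf.1.sum_mem (t := Finset.univ) (w := fun _ => n⁻¹)
    (z := fun i => x + S i (n • p i h)) (fun _ _ => by positivity) hw (fun i _ => (Q i).1)
  have mm := hf.1.sum_mem (t := Finset.univ) (w := fun _ => n⁻¹)
    (z := fun i => x - S i (n • p i h)) (fun _ _ => by positivity) hw (fun i _ => (Q i).2.1)
  simp only [ep, em, smul_eq_mul, ← Finset.mul_sum] at jp jm mp mm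
  have hsum : ∑ i, f (x + S i (n • p i h)) + ∑ i, f (x - S i (n • p i h)) ≤
      n * (2 * f x + ε / (2 * n * R) * s) := by
    rw [← Finset.sum_add_distrib]
    refine (Finset.sum_le_card_nsmul _ _ (2 * f x + ε / (2 * n * R) * s) fun i _ => ?_).trans
      (by rw [nsmul_eq_mul, Finset.card_univ, hn])
    linarith [(Q i).2.2]
  have hsum2 := mul_le_mul_of_nonneg_left hsum (inv_nonneg.2 hn0.le)
  rw [← mul_assoc, inv_mul_cancel₀ hn0.ne', one_mul, mul_add] at hsum2
  have es : ε / (2 * n * R) * s = ε / 2 * |t| := by rw [hs]; field_simp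
  rw [es] at hsum2
  have g1 := hL _ mp
  have g2 := hL _ mm
  simp only [add_sub_cancel_left, sub_sub_cancel_left, map_neg] at g1 g2
  have hLh : L h = t * L b := by rw [hh, map_smul, smul_eq_mul]
  have ht0 : t ≠ 0 := abs_pos.1 ht
  have : (f (x + h) - f x) / t - L b = (f (x + h) - f x - L h) / t := by
    rw [hLh]; field_simp
  rw [this, abs_div, div_lt_iff₀ ht, abs_of_nonneg (by linarith)]
  nlinarith

lemma exists_G {ι : Type*} [Fintype ι] [CompleteSpace X] {W : ι → Type*}
    [∀ i, NormedAddCommGroup (W i)] [∀ i, NormedSpace ℝ (W i)]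
    (S : ∀ i, W i →L[ℝ] X) (p : ∀ i, X → W i) (hp : ∀ i h, ‖p i h‖ ≤ ‖h‖)
    (hS : ∀ h, ∑ i, S i (p i h) = h)
    (hD : IsOpen D) (hc : ContinuousOn f D) (hf : ConvexOn ℝ D f)
    (H : ∀ i, ∀ ε > 0, D ⊆ closure (smallOsc D f (S i) ε)) :
    ∃ G : Set X, G ⊆ D ∧ IsGδ (Subtype.val ⁻¹' G : Set D) ∧
      Dense (Subtype.val ⁻¹' G : Set D) ∧ ∀ x ∈ G, FrechetDiffAt f x := by
  have := hD.baireSpace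
  set O : ι × ℕ → Set X := fun q => smallOsc D f (S q.1) (1 / ((q.2 : ℝ) + 1)) with hO
  have hpre : (Subtype.val ⁻¹' (D ∩ ⋂ q, O q) : Set D) = ⋂ q, Subtype.val ⁻¹' O q := by
    ext x; simp
  refine ⟨D ∩ ⋂ q, O q, Set.inter_subset_left, ?_, ?_, ?_⟩
  · rw [hpre]
    exact IsGδ.iInter fun q => (isOpen_smallOsc.preimage continuous_subtype_val).isGδ
  · rw [hpre]
    refine dense_iInter_of_isOpen (fun q => isOpen_smallOsc.preimage continuous_subtype_val) ?_
    intro q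
    rw [Subtype.dense_iff]
    intro x hx
    rw [Subtype.image_preimage_coe, Set.inter_eq_right.2 smallOsc_subset]
    exact H q.1 _ (by positivity) hx
  · rintro x ⟨hx, hx2⟩
    refine frechet_of_smallOsc S p hp hS hD hc hf hx fun i ε hε => ?_
    obtain ⟨m, hm⟩ := exists_nat_one_div_lt hε
    obtain ⟨r, hr, K, h1, h2, δ, hδ, c, hcm, h3⟩ := Set.mem_iInter.1 hx2 (i, m)
    exact ⟨r, hr, K, h1, h2, δ, hδ, c, hcm.trans hm, h3⟩

lemma dense_of_asplund (hV : IsAsplund V) (hD : IsOpen D) (hc : ContinuousOn f D)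
    (hf : ConvexOn ℝ D f) {ε : ℝ} (hε : 0 < ε) : D ⊆ closure (smallOsc D f T ε) := by
  intro y hy
  rw [mem_closure_iff]
  intro O hO hyO
  have hcont : Continuous fun v : V => y + T v := by fun_prop
  have hDy : IsOpen ((fun v : V => y + T v) ⁻¹' D) := hD.preimage hcont
  have hconv : ConvexOn ℝ ((fun v : V => y + T v) ⁻¹' D) (fun v => f (y + T v)) := by
    have e : ∀ (a b : V) (s t : ℝ), s + t = 1 →
        y + T (s • a + t • b) = s • (y + T a) + t • (y + T b) := by
      intro a b s t hst
      have : y = (s + t) • y := by rw [hst, one_smul]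
      rw [map_add, map_smul, map_smul]
      nth_rewrite 1 [this]
      module
    constructor
    · intro a ha b hb s t hs ht hst
      simp only [Set.mem_preimage] at *
      rw [e a b s t hst]
      exact hf.1 ha hb hs ht hst
    · intro a ha b hb s t hs ht hst
      simp only [Set.mem_preimage] at *
      rw [e a b s t hst]
      exact hf.2 ha hb hs ht hst
  have h0 : (0 : V) ∈ (fun v : V => y + T v) ⁻¹' D := by simpa using hy
  obtain ⟨G, hGD, -, hGd, hG⟩ := hV _ (fun v => f (y + T v)) ⟨0, h0⟩ hDy hconv.1
    (hc.comp hcont.continuousOn fun v hv => hv) hconv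
  obtain ⟨v, hv1, hv2⟩ := hGd.exists_mem_open
    ((hO.preimage hcont).preimage continuous_subtype_val) ⟨⟨0, h0⟩, by simpa using hyO⟩
  have hvG : (v : V) ∈ G := hv1
  refine ⟨y + T v, hv2, mem_smallOsc_of_frechet hD
    ((hf.locallyLipschitzOn_iff_continuousOn hD).2 hc) v.2 ?_ hε⟩
  obtain ⟨L, hL⟩ := hG _ hvG
  refine ⟨L, fun B hB e he => ?_⟩
  obtain ⟨δ, hδ, h⟩ := hL B hB e he
  refine ⟨δ, hδ, fun t h1 h2 b hb => ?_⟩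
  simpa [add_assoc] using h t h1 h2 b hb

/-- Finite products of Asplund Banach spaces are Asplund. -/
lemma asplund_finite_pi {ι : Type*} [Fintype ι] {W : ι → Type*}
    [∀ i, NormedAddCommGroup (W i)] [∀ i, NormedSpace ℝ (W i)] [∀ i, CompleteSpace (W i)]
    (h : ∀ i, IsAsplund (W i)) : IsAsplund (∀ i, W i) := by
  classical
  intro D f _ hD _ hc hf
  refine exists_G (fun i => ContinuousLinearMap.single ℝ W i) (fun i x => x i)
    (fun i x => norm_le_pi_norm x i) (fun x => ?_) hD hc hf
    fun i ε hε => dense_of_asplund (h i) hD hc hf hε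
  simpa using Finset.univ_sum_single x

end Aux

section Factor

variable {Y : Type*} [AddCommGroup Y] [Module ℝ Y]

/-- A convex function bounded above near a point along a subspace is invariant along it. -/
lemma convex_invariant {D : Set Y} {f : Y → ℝ} (hf : ConvexOn ℝ D f) (N : Submodule ℝ Y) {x₀ : Y}
    (hline : ∀ z ∈ D, ∃ s > (0 : ℝ), z + s • (z - x₀) ∈ D)
    {M : ℝ} (hN : ∀ v ∈ N, x₀ + v ∈ D ∧ f (x₀ + v) ≤ M) {z v : Y} (hz : z ∈ D) (hv : v ∈ N) :
    z + v ∈ D ∧ f (z + v) = f z := by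
  have bd : ∀ z ∈ D, ∃ C, ∀ v ∈ N, z + v ∈ D ∧ f (z + v) ≤ C := by
    intro z hz
    obtain ⟨s, hs, hy⟩ := hline z hz
    set y := z + s • (z - x₀) with hydef
    have h1 : 0 ≤ 1 / (1 + s) := by positivity
    have h2 : 0 ≤ s / (1 + s) := by positivity
    have h12 : 1 / (1 + s) + s / (1 + s) = 1 := by field_simp
    refine ⟨1 / (1 + s) * f y + s / (1 + s) * M, fun v hv => ?_⟩
    obtain ⟨k1, k2⟩ := hN (((1 + s) / s) • v) (N.smul_mem _ hv)
    have e : z + v = (1 / (1 + s)) • y + (s / (1 + s)) • (x₀ + ((1 + s) / s) • v) := by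
      rw [hydef]
      match_scalars <;> field_simp <;> ring
    rw [e]
    refine ⟨hf.1 hy k1 h1 h2 h12, (hf.2 hy k1 h1 h2 h12).trans ?_⟩
    simp only [smul_eq_mul]
    gcongr
  have le : ∀ z ∈ D, ∀ v ∈ N, f (z + v) ≤ f z := by
    intro z hz v hv
    obtain ⟨C, hC⟩ := bd z hz
    have hn : ∀ n : ℕ, f (z + v) ≤ f z + (C - f z) * (1 / ((n : ℝ) + 1)) := by
      intro n
      obtain ⟨k1, k2⟩ := hC (((n : ℝ) + 1) • v) (N.smul_mem _ hv)
      have hp : (0 : ℝ) < (n : ℝ) + 1 := by positivity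
      have h1 : (0 : ℝ) ≤ 1 / ((n : ℝ) + 1) := by positivity
      have h2 : (0 : ℝ) ≤ 1 - 1 / ((n : ℝ) + 1) := by
        rw [sub_nonneg, div_le_one hp]; linarith [(Nat.cast_nonneg n : (0 : ℝ) ≤ n)]
      have e : z + v = (1 - 1 / ((n : ℝ) + 1)) • z +
          (1 / ((n : ℝ) + 1)) • (z + ((n : ℝ) + 1) • v) := by
        match_scalars <;> field_simp <;> ring
      have := hf.2 hz k1 h2 h1 (by ring)
      rw [← e] at this
      simp only [smul_eq_mul] at this
      have := mul_le_mul_of_nonneg_left k2 h1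
      nlinarith
    have lim : Tendsto (fun n : ℕ => f z + (C - f z) * (1 / ((n : ℝ) + 1))) atTop
        (𝓝 (f z + (C - f z) * 0)) :=
      (tendsto_one_div_add_atTop_nhds_zero_nat.const_mul _).const_add _
    rw [mul_zero, add_zero] at lim
    exact ge_of_tendsto' lim hn
  obtain ⟨C, hC⟩ := bd z hz
  have hm := (hC v hv).1
  refine ⟨hm, le_antisymm (le z hz v hv) ?_⟩
  have := le _ hm (-v) (N.neg_mem hv)
  rwa [add_neg_cancel_right] at this

/-- Transfer of the conclusion along a split surjection. -/
lemma transfer {X : Type*} [AddCommGroup X] [Module ℝ X] [TopologicalSpace X]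
    [TopologicalSpace Y] [IsTopologicalAddGroup Y] [ContinuousSMul ℝ Y]
    (hX : IsAsplund X) (P : Y →L[ℝ] X) (J : X →L[ℝ] Y) (hPJ : ∀ x, P (J x) = x)
    (hPo : IsOpenMap P)
    {D : Set Y} {f : Y → ℝ} (hne : D.Nonempty) (hD : IsOpen D) (hc : ContinuousOn f D)
    (hf : ConvexOn ℝ D f)
    (hinv : ∀ z w, P z = P w → z ∈ D → w ∈ D ∧ f w = f z) :
    ∃ G : Set Y, G ⊆ D ∧ IsGδ (Subtype.val ⁻¹' G : Set D) ∧
      Dense (Subtype.val ⁻¹' G : Set D) ∧ ∀ x ∈ G, FrechetDiffAt f x := by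
  have hmem : ∀ z ∈ D, J (P z) ∈ D ∧ f (J (P z)) = f z := fun z hz => hinv z _ (hPJ _).symm hz
  have hmem' : ∀ z, P z ∈ J ⁻¹' D → z ∈ D := fun z hz => (hinv _ z (hPJ _) hz).1
  obtain ⟨z₀, hz₀⟩ := hne
  have hconv : ConvexOn ℝ (J ⁻¹' D) (f ∘ J) := hf.comp_linearMap (J : X →ₗ[ℝ] Y)
  obtain ⟨G, hGD, hGδ, hGd, hG⟩ := hX (J ⁻¹' D) (f ∘ J) ⟨P z₀, (hmem _ hz₀).1⟩
    (hD.preimage J.continuous) hconv.1 (hc.comp J.continuous.continuousOn fun x hx => hx) hconv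
  let Q : D → (J ⁻¹' D : Set X) := fun z => ⟨P z, (hmem z z.2).1⟩
  have hQ : Continuous Q := by
    refine Continuous.subtype_mk ?_ _
    exact P.continuous.comp continuous_subtype_val
  refine ⟨P ⁻¹' G, fun z hz => hmem' z (hGD hz), ?_, ?_, ?_⟩
  · obtain ⟨g, hg, hge⟩ := isGδ_iff_eq_iInter_nat.1 hGδ
    have e : (Subtype.val ⁻¹' (P ⁻¹' G) : Set D) = ⋂ n, Q ⁻¹' g n := by
      rw [← Set.preimage_iInter, ← hge]; rfl
    rw [e]
    exact IsGδ.iInter fun n => ((hg n).preimage hQ).isGδ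
  · rw [dense_iff_inter_open]
    rintro U hU ⟨z, hzU⟩
    obtain ⟨O, hO, rfl⟩ := isOpen_induced_iff.1 hU
    have hO2 : IsOpen (P '' (O ∩ D)) := hPo _ (hO.inter hD)
    obtain ⟨x, hxG, w, hw, hwx⟩ := hGd.exists_mem_open
      (hO2.preimage continuous_subtype_val) ⟨Q z, (z : Y), ⟨hzU, z.2⟩, rfl⟩
    refine ⟨⟨w, hw.2⟩, hw.1, ?_⟩
    change P w ∈ G
    rw [hwx]; exact hxG
  · intro z hz
    have hzD : z ∈ D := hmem' z (hGD hz)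
    obtain ⟨L, hL⟩ := hG _ hz
    refine ⟨L.comp P, fun B hB ε hε => ?_⟩
    obtain ⟨δ, hδ, H⟩ := hL (P '' B) (hB.image P) ε hε
    have hnb : (fun y => z + y) ⁻¹' D ∈ 𝓝 (0 : Y) := by
      refine (hD.preimage (by fun_prop)).mem_nhds ?_
      simpa using hzD
    have hab := (hB hnb).eventually_nhds_zero (by simpa using hzD)
    obtain ⟨δ', hδ', H'⟩ := Metric.eventually_nhds_iff.1 hab
    refine ⟨min δ δ', lt_min hδ hδ', fun t ht htd b hb => ?_⟩
    have hb1 : z + t • b ∈ D :=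
      H' (y := t) (by simpa using htd.trans_le (min_le_right _ _)) hb
    have := H t ht (htd.trans_le (min_le_left _ _)) (P b) ⟨b, hb, rfl⟩
    simp only [Function.comp_apply] at this
    rw [← map_smul, ← map_add, (hmem _ hb1).2, (hmem _ hzD).2] at this
    exact this

end Factor

lemma pi_of_factors {A : Type*} (E : A → Type*)
    [∀ α, NormedAddCommGroup (E α)] [∀ α, NormedSpace ℝ (E α)] [∀ α, CompleteSpace (E α)]
    (h : ∀ α, IsAsplund (E α)) : IsAsplund (∀ α, E α) := by
  classical
  intro D f hne hD hDc hc hf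
  obtain ⟨x₀, hx₀⟩ := hne
  have hnb : {z | z ∈ D ∧ f z < f x₀ + 1} ∈ 𝓝 x₀ := by
    have h1 : ∀ᶠ z in 𝓝 x₀, f z < f x₀ + 1 :=
      (hc.continuousAt (hD.mem_nhds hx₀)).eventually_lt_const (by linarith)
    filter_upwards [h1, hD.mem_nhds hx₀] with z hz1 hz2 using ⟨hz2, hz1⟩
  rw [nhds_pi, Filter.mem_pi'] at hnb
  obtain ⟨I, t, ht, hIt⟩ := hnb
  let P : (∀ α, E α) →L[ℝ] (∀ i : I, E i) :=
    ContinuousLinearMap.pi fun i => ContinuousLinearMap.proj (i : A)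
  let J : (∀ i : I, E i) →L[ℝ] (∀ α, E α) :=
    ContinuousLinearMap.pi fun α =>
      if hα : α ∈ I then ContinuousLinearMap.proj (R := ℝ) (φ := fun i : I => E i) ⟨α, hα⟩ else 0
  have hPJ : ∀ x, P (J x) = x := by
    intro x
    ext i
    simp [P, J]
  have hPo : IsOpenMap P := by
    intro O hO
    rw [isOpen_iff_mem_nhds]
    rintro _ ⟨z, hz, rfl⟩
    have hcont : Continuous fun x => z + J (x - P z) := by fun_prop
    have : (fun x => z + J (x - P z)) ⁻¹' O ∈ 𝓝 (P z) :=
      (hO.preimage hcont).mem_nhds (by simpa using hz)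
    filter_upwards [this] with x hx
    exact ⟨_, hx, by simp [hPJ]⟩
  refine transfer (asplund_finite_pi fun i : I => h i) P J hPJ hPo ⟨x₀, hx₀⟩ hD hc hf ?_
  intro z w hzw hz
  have := convex_invariant hf (LinearMap.ker (P : (∀ α, E α) →ₗ[ℝ] (∀ i : I, E i))) (x₀ := x₀)
    (M := f x₀ + 1) ?_ ?_ hz (v := w - z) ?_
  · simpa using this
  · intro z hz
    have hcont : Continuous fun s : ℝ => z + s • (z - x₀) := by fun_prop
    have h0 : (fun s : ℝ => z + s • (z - x₀)) ⁻¹' D ∈ 𝓝 (0 : ℝ) :=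
      (hD.preimage hcont).mem_nhds (by simpa using hz)
    obtain ⟨r, hr, hrs⟩ := Metric.mem_nhds_iff.1 h0
    refine ⟨r / 2, by positivity, hrs ?_⟩
    simp [abs_of_pos hr, hr]
  · intro v hv
    have : x₀ + v ∈ {z | z ∈ D ∧ f z < f x₀ + 1} := by
      apply hIt
      intro i hi
      have hvi : v i = 0 := congrFun (LinearMap.mem_ker.1 hv) ⟨i, hi⟩
      simpa [hvi] using mem_of_mem_nhds (ht i)
    exact ⟨this.1, this.2.le⟩
  · simp [LinearMap.mem_ker, hzw]

lemma factor_of_pi {A : Type*} (E : A → Type*)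
    [∀ α, NormedAddCommGroup (E α)] [∀ α, NormedSpace ℝ (E α)] [∀ α, CompleteSpace (E α)]
    (h : IsAsplund (∀ α, E α)) (α : A) : IsAsplund (E α) := by
  classical
  intro D f hne hD hDc hc hf
  refine exists_G (ι := Unit) (fun _ => ContinuousLinearMap.id ℝ (E α)) (fun _ x => x)
    (fun _ _ => le_rfl) (fun _ => by simp) hD hc hf fun _ ε hε y hy => ?_
  rw [mem_closure_iff]
  intro O hO hyO
  let P : (∀ β, E β) →L[ℝ] E α := ContinuousLinearMap.proj α
  let J : E α →L[ℝ] (∀ β, E β) := ContinuousLinearMap.single ℝ E α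
  have hPJ : ∀ x, P (J x) = x := fun x => by simp [P, J]
  have hconv : ConvexOn ℝ (P ⁻¹' D) (f ∘ P) := hf.comp_linearMap (P : (∀ β, E β) →ₗ[ℝ] E α)
  obtain ⟨G, hGD, -, hGd, hG⟩ := h (P ⁻¹' D) (f ∘ P) ⟨J y, by simpa [hPJ] using hy⟩
    (hD.preimage P.continuous) hconv.1 (hc.comp P.continuous.continuousOn fun x hx => hx) hconv
  obtain ⟨z, hzG, hzO⟩ := hGd.exists_mem_open
    ((hO.preimage P.continuous).preimage continuous_subtype_val)
    ⟨⟨J y, by simpa [hPJ] using hy⟩, by simpa [hPJ] using hyO⟩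
  refine ⟨P z, hzO, mem_smallOsc_of_frechet hD
    ((hf.locallyLipschitzOn_iff_continuousOn hD).2 hc) z.2 ?_ hε⟩
  obtain ⟨L, hL⟩ := hG z hzG
  refine ⟨L.comp J, fun B hB e he => ?_⟩
  obtain ⟨δ, hδ, H⟩ := hL (J '' B) (hB.image J) e he
  refine ⟨δ, hδ, fun t h1 h2 b hb => ?_⟩
  simpa [hPJ] using H t h1 h2 (J b) ⟨b, hb, rfl⟩

/-- The product of an arbitrary family of real Banach spaces is an Asplund locally convex
space if and only if every factor is an Asplund space. -/
theorem isAsplund_pi_banach_iff {A : Type*} (E : A → Type*)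
    [∀ α, NormedAddCommGroup (E α)] [∀ α, NormedSpace ℝ (E α)] [∀ α, CompleteSpace (E α)] :
    IsAsplund (∀ α, E α) ↔ ∀ α, IsAsplund (E α) := by
  exact ⟨factor_of_pi E, pi_of_factors E⟩
end

section
/- Let {E_α : α ∈ A} be an arbitrary family of real Banach spaces. Then the Σ-product Y of {E_α : α ∈ A} with base point 0 (the subspace of ∏_{α∈A} E_α consisting of points x = (x_α) with x_α = 0 for all but countably many α, with the topology induced from the product) is an Asplund locally convex space if and only if every E_α is an Asplund space. -/
open Filter Topology Bornology TopologicalSpace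

/-- The Σ-product (with base point `0`) of a family of modules: the submodule of the product
consisting of the points all but countably many of whose coordinates are `0`; as a topological
space it carries the topology induced from the product. -/
def sigmaProduct {A : Type*} (E : A → Type*) [∀ α, AddCommGroup (E α)]
    [∀ α, Module ℝ (E α)] : Submodule ℝ (∀ α, E α) where
  carrier := {x | {α | x α ≠ 0}.Countable}
  add_mem' := fun {x y} hx hy => Set.Countable.mono
    (fun α hα => by
      by_contra h
      simp only [Set.mem_union, Set.mem_setOf_eq, not_or, not_not] at h
      exact hα (by simp [Pi.add_apply, h.1, h.2]))
    (hx.union hy)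
  zero_mem' := by simp
  smul_mem' := fun c x hx => Set.Countable.mono
    (fun α hα => by
      simp only [Set.mem_setOf_eq] at hα ⊢
      intro h
      exact hα (by simp [Pi.smul_apply, h]))
    hx

section Aux

variable {P : Type*} [NormedAddCommGroup P] [NormedSpace ℝ P]

/-- `φ` is a subgradient of `f` (on `D`) at `x`. -/
def SubgAt (D : Set P) (f : P → ℝ) (x : P) (φ : P →L[ℝ] ℝ) : Prop :=
  ∀ y ∈ D, f x + φ (y - x) ≤ f y

/-- Points near which the subdifferential has oscillation at most `ε`. -/
def oscSet (D : Set P) (f : P → ℝ) (ε : ℝ) : Set P :=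
  {x | ∃ V : Set P, IsOpen V ∧ x ∈ V ∧ V ⊆ D ∧ ∀ v ∈ V, ∀ w ∈ V, ∀ φ ψ : P →L[ℝ] ℝ,
    SubgAt D f v φ → SubgAt D f w ψ → ‖φ - ψ‖ ≤ ε}

lemma isOpen_oscSet (D : Set P) (f : P → ℝ) (ε : ℝ) : IsOpen (oscSet D f ε) := by
  rw [isOpen_iff_mem_nhds]
  rintro x ⟨V, hV, hx, h⟩
  exact mem_of_superset (hV.mem_nhds hx) fun y hy => ⟨V, hV, hy, h⟩

lemma norm_le_of_ball_le {φ : P →L[ℝ] ℝ} {r C : ℝ} (hr : 0 < r)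
    (h : ∀ x : P, ‖x‖ ≤ r → φ x ≤ C) : ‖φ‖ ≤ C / r := by
  have hC : 0 ≤ C := by simpa using h 0 (by simpa using hr.le)
  refine ContinuousLinearMap.opNorm_le_bound _ (by positivity) fun x => ?_
  rcases eq_or_ne x 0 with rfl | hx
  · simp
  have hx' : 0 < ‖x‖ := norm_pos_iff.2 hx
  have hn : ‖(r / ‖x‖) • x‖ ≤ r := by
    rw [norm_smul, Real.norm_eq_abs, abs_of_pos (by positivity), div_mul_cancel₀ _ hx'.ne']
  have h1 := h ((r / ‖x‖) • x) hn
  have h2 := h (-((r / ‖x‖) • x)) (by rwa [norm_neg])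
  rw [map_neg] at h2
  rw [map_smul, smul_eq_mul] at h1 h2
  have h3 : (r / ‖x‖) * |φ x| ≤ C := by
    rcases abs_cases (φ x) with ⟨h, _⟩ | ⟨h, _⟩ <;> rw [h] <;> linarith
  rw [Real.norm_eq_abs]
  rw [div_mul_eq_mul_div, div_le_iff₀ hx'] at h3
  rw [div_mul_eq_mul_div, le_div_iff₀ hr]
  linarith

lemma exists_subgAt {D : Set P} {f : P → ℝ} (hD : IsOpen D)
    (hf : ContinuousOn f D) (hfc : ConvexOn ℝ D f) {x : P} (hx : x ∈ D) :
    ∃ φ, SubgAt D f x φ := by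
  have hconv : Convex ℝ {p : P × ℝ | p.1 ∈ D ∧ f p.1 < p.2} := hfc.convex_strict_epigraph
  have hopen : IsOpen {p : P × ℝ | p.1 ∈ D ∧ f p.1 < p.2} := by
    have h1 : IsOpen (D ×ˢ (Set.univ : Set ℝ)) := hD.prod isOpen_univ
    have h2 : ContinuousOn (fun p : P × ℝ => p.2 - f p.1) (D ×ˢ (Set.univ : Set ℝ)) :=
      continuousOn_snd.sub (hf.comp continuousOn_fst (fun p hp => hp.1))
    have h3 := h2.isOpen_inter_preimage h1 (isOpen_Ioi (a := (0:ℝ)))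
    convert h3 using 1
    ext p
    simp
  obtain ⟨g, hg⟩ := geometric_hahn_banach_open_point hconv hopen
    (x := (x, f x)) (by simp)
  have hsplit : ∀ (y : P) (r : ℝ), g (y, r) = g (y, 0) + r * g (0, 1) := by
    intro y r
    have : ((y, r) : P × ℝ) = (y, 0) + r • (0, 1) := by simp
    rw [this, map_add, map_smul, smul_eq_mul]
  have hc : g (0, 1) < 0 := by
    have := hg (x, f x + 1) ⟨hx, by simp⟩
    rw [hsplit x (f x + 1), hsplit x (f x)] at this
    linarith
  set c := g (0, 1) with hcdef
  refine ⟨(-c)⁻¹ • g.comp (ContinuousLinearMap.inl ℝ P ℝ), fun y hy => ?_⟩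
  have key : g (y, 0) + f y * c ≤ g (x, 0) + f x * c := by
    refine le_of_forall_pos_le_add fun e he => ?_
    have := hg (y, f y + e / (-c)) ⟨hy, by
      have : 0 < e / (-c) := div_pos he (by linarith)
      simpa using this⟩
    rw [hsplit y, hsplit x (f x)] at this
    have h2 : e / (-c) * c = -e := by rw [div_mul_eq_mul_div, div_neg, mul_div_assoc, div_self hc.ne, mul_one]
    linarith [add_mul (f y) (e / (-c)) c]
  have h3 : g (y - x, 0) = g (y, 0) - g (x, 0) := by
    rw [← map_sub]; simp
  have h4 : (-c)⁻¹ * (g (y, 0) - g (x, 0)) ≤ f y - f x := by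
    rw [inv_mul_le_iff₀ (by linarith)]
    linarith
  simp [h3]
  have h5 : (-c)⁻¹ = -c⁻¹ := by rw [inv_neg]
  rw [h5] at h4
  linarith

lemma subg_locBdd {D : Set P} {f : P → ℝ} (hD : IsOpen D)
    (hf : ContinuousOn f D) {x : P} (hx : x ∈ D) :
    ∃ K : ℝ, 0 ≤ K ∧ ∃ V : Set P, IsOpen V ∧ x ∈ V ∧ V ⊆ D ∧ ∀ v ∈ V, ∀ φ : P →L[ℝ] ℝ,
      SubgAt D f v φ → ‖φ‖ ≤ K := by
  have hc : ContinuousAt f x := hf.continuousAt (hD.mem_nhds hx)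
  have h1 : ∀ᶠ y in 𝓝 x, |f y - f x| < 1 := by
    have := Metric.continuousAt_iff'.1 hc 1 one_pos
    simpa [Real.dist_eq] using this
  obtain ⟨r, hr, hball⟩ := Metric.eventually_nhds_iff_ball.1 (h1.and (hD.mem_nhds hx))
  refine ⟨2 / (r / 4), by positivity, Metric.ball x (r/2), Metric.isOpen_ball,
    Metric.mem_ball_self (by positivity), fun y hy => ?_, fun v hv φ hφ => ?_⟩
  · exact (hball y (Metric.ball_subset_ball (by linarith) hy)).2
  · have hle : ∀ h : P, ‖h‖ ≤ r / 4 → φ h ≤ 2 := by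
      intro h hh
      have hv' := hball v (Metric.ball_subset_ball (by linarith) hv)
      have hw' := hball (v + h) (by
        rw [Metric.mem_ball, dist_eq_norm] at hv ⊢
        calc ‖v + h - x‖ = ‖(v - x) + h‖ := by congr 1; abel
          _ ≤ ‖v - x‖ + ‖h‖ := norm_add_le _ _
          _ < r := by linarith)
      have := hφ (v + h) hw'.2
      rw [add_sub_cancel_left] at this
      have a := abs_lt.1 hv'.1
      have b := abs_lt.1 hw'.1
      linarith
    exact norm_le_of_ball_le (by positivity) hle

lemma mem_oscSet_of_frechet {D : Set P} {f : P → ℝ} (hD : IsOpen D)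
    (hf : ContinuousOn f D) {x : P} (hx : x ∈ D) (hF : FrechetDiffAt f x)
    {ε : ℝ} (hε : 0 < ε) : x ∈ oscSet D f ε := by
  obtain ⟨L, hL⟩ := hF
  obtain ⟨K, hK0, V, hVo, hxV, hVD, hK⟩ := subg_locBdd hD hf hx
  obtain ⟨δ, hδ, hL⟩ := hL (Metric.closedBall 0 1) (NormedSpace.isVonNBounded_closedBall ℝ P 1)
    (ε / 8) (by positivity)
  obtain ⟨r, hr, hball⟩ := Metric.isOpen_iff.1 hD x hx
  obtain ⟨t, ht0, htm⟩ := exists_between (lt_min hδ hr)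
  have htδ : t < δ := htm.trans_le (min_le_left _ _)
  have htr : t < r := htm.trans_le (min_le_right _ _)
  have hc : ContinuousAt f x := hf.continuousAt (hD.mem_nhds hx)
  have hc2 : ContinuousAt (fun v => (f x - f v) + K * ‖v - x‖) x := by fun_prop
  have h1 : ∀ᶠ v in 𝓝 x, (f x - f v) + K * ‖v - x‖ < t * (ε / 8) := by
    apply hc2.eventually_lt continuousAt_const
    simp only [sub_self, norm_zero, mul_zero, add_zero]
    positivity
  obtain ⟨W, hW, hWo, hxW⟩ := eventually_nhds_iff.1 h1
  have key : ∀ v ∈ V ∩ W, ∀ ψ : P →L[ℝ] ℝ, SubgAt D f v ψ → ‖ψ - L‖ ≤ ε / 4 := by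
    intro v hv ψ hψ
    have := norm_le_of_ball_le (φ := ψ - L) (r := 1) (C := ε / 4) one_pos (by
      intro h hh
      have a1 := hL t (by rwa [abs_of_pos ht0]) (by rwa [abs_of_pos ht0]) h (by simpa using hh)
      have a2 := (abs_lt.1 a1).2
      have a3 : f (x + t • h) - f x < t * (L h + ε / 8) := by
        rw [sub_lt_iff_lt_add, div_lt_iff₀ ht0] at a2
        linarith
      have hmem : x + t • h ∈ D := hball (by
        rw [Metric.mem_ball, dist_eq_norm, add_sub_cancel_left, norm_smul, Real.norm_eq_abs,
          abs_of_pos ht0]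
        nlinarith)
      have a4 := hψ _ hmem
      have a5 : ψ (x + t • h - v) = t * ψ h - ψ (v - x) := by
        rw [← smul_eq_mul, ← map_smul, ← map_sub]; congr 1; abel
      have a6 : ψ (v - x) ≤ K * ‖v - x‖ :=
        (le_abs_self _).trans ((ψ.le_opNorm _).trans
          (mul_le_mul_of_nonneg_right (hK v hv.1 ψ hψ) (norm_nonneg _)))
      have a7 := hW v hv.2
      have a8 : t * (ψ h - L h) ≤ t * (ε / 4) := by linarith
      exact le_of_mul_le_mul_left a8 ht0)
    simpa using this
  refine ⟨V ∩ W, hVo.inter hWo, ⟨hxV, hxW⟩, fun y hy => hVD hy.1, ?_⟩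
  intro v hv w hw φ ψ hφ hψ
  have b1 := key v hv φ hφ
  have b2 := key w hw ψ hψ
  calc ‖φ - ψ‖ = ‖(φ - L) - (ψ - L)‖ := by congr 1; abel
    _ ≤ ‖φ - L‖ + ‖ψ - L‖ := norm_sub_le _ _
    _ ≤ ε := by linarith

lemma frechet_of_mem_oscSet {D : Set P} {f : P → ℝ} (hD : IsOpen D)
    (hf : ContinuousOn f D) (hfc : ConvexOn ℝ D f) {x : P} (hx : x ∈ D)
    (h : ∀ ε : ℝ, 0 < ε → x ∈ oscSet D f ε) : FrechetDiffAt f x := by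
  obtain ⟨φ, hφ⟩ := exists_subgAt hD hf hfc hx
  refine ⟨φ, fun B hB ε hε => ?_⟩
  obtain ⟨R, hR⟩ := (NormedSpace.isVonNBounded_iff ℝ |>.1 hB).exists_norm_le
  obtain ⟨R', hR'0, hRR'⟩ : ∃ R' : ℝ, 0 < R' ∧ R ≤ R' :=
    ⟨max R 1, by positivity, le_max_left _ _⟩
  obtain ⟨V, hVo, hxV, hVD, hV⟩ := h (ε / (2 * R')) (by positivity)
  obtain ⟨r, hr, hball⟩ := Metric.isOpen_iff.1 hVo x hxV
  refine ⟨r / R', by positivity, fun t ht0 ht y hy => ?_⟩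
  have hyR : ‖y‖ ≤ R' := (hR y hy).trans hRR'
  have hv : x + t • y ∈ V := hball (by
    rw [Metric.mem_ball, dist_eq_norm, add_sub_cancel_left, norm_smul, Real.norm_eq_abs]
    rw [lt_div_iff₀ hR'0] at ht
    nlinarith)
  obtain ⟨ψ, hψ⟩ := exists_subgAt hD hf hfc (hVD hv)
  have c1 := hφ _ (hVD hv)
  have c2 := hψ _ hx
  rw [add_sub_cancel_left, map_smul, smul_eq_mul] at c1
  rw [sub_add_cancel_left, map_neg, map_smul, smul_eq_mul] at c2
  have c3 := hV _ hv _ hxV ψ φ hψ hφ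
  have c4 : |ψ y - φ y| ≤ ε / 2 := by
    calc |ψ y - φ y| = ‖(ψ - φ) y‖ := by simp
      _ ≤ ‖ψ - φ‖ * ‖y‖ := (ψ - φ).le_opNorm y
      _ ≤ ε / (2 * R') * R' := by gcongr
      _ = ε / 2 := by field_simp
  have c5 : |f (x + t • y) - f x - t * φ y| ≤ |t| * (ε / 2) := by
    rw [abs_of_nonneg (by linarith)]
    calc f (x + t • y) - f x - t * φ y ≤ t * (ψ y - φ y) := by linarith
      _ ≤ |t * (ψ y - φ y)| := le_abs_self _
      _ = |t| * |ψ y - φ y| := abs_mul _ _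
      _ ≤ |t| * (ε / 2) := by gcongr
  have ht' : t ≠ 0 := abs_pos.1 ht0
  have c6 : (f (x + t • y) - f x) / t - φ y = (f (x + t • y) - f x - t * φ y) / t := by
    field_simp
  rw [c6, abs_div, div_lt_iff₀ ht0]
  nlinarith

lemma exists_slice {X : Type*} [NormedAddCommGroup X] [NormedSpace ℝ X] (hX : IsAsplund X)
    {S : Set (X →L[ℝ] ℝ)} (hS : S.Nonempty) {K : ℝ} (hK : ∀ φ ∈ S, ‖φ‖ ≤ K)
    {ε : ℝ} (hε : 0 < ε) :
    ∃ (z : X) (c : ℝ), (∃ φ ∈ S, c < φ z) ∧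
      ∀ φ ∈ S, ∀ ψ ∈ S, c < φ z → c < ψ z → ‖φ - ψ‖ ≤ ε := by
  have : Nonempty S := hS.to_subtype
  have hK0 : 0 ≤ K := (norm_nonneg _).trans (hK _ hS.some_mem)
  have hle : ∀ φ ∈ S, ∀ y : X, |φ y| ≤ K * ‖y‖ := fun φ hφ y =>
    (φ.le_opNorm y).trans (mul_le_mul_of_nonneg_right (hK φ hφ) (norm_nonneg _))
  set p : X → ℝ := fun y => ⨆ φ : S, φ.1 y with hp
  have hbdd : ∀ y, BddAbove (Set.range fun φ : S => φ.1 y) := fun y =>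
    ⟨K * ‖y‖, by rintro _ ⟨φ, rfl⟩; exact (le_abs_self _).trans (hle φ.1 φ.2 y)⟩
  have hpge : ∀ φ ∈ S, ∀ y, φ y ≤ p y := fun φ hφ y => le_ciSup (hbdd y) ⟨φ, hφ⟩
  have hple : ∀ y c, (∀ φ ∈ S, φ y ≤ c) → p y ≤ c := fun y c h =>
    ciSup_le fun φ => h φ.1 φ.2
  have hconv : ConvexOn ℝ Set.univ p := by
    refine ⟨convex_univ, fun x _ y _ a b ha hb hab => ?_⟩
    refine hple _ _ fun φ hφ => ?_
    rw [map_add, map_smul, map_smul]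
    simp only [smul_eq_mul]
    exact add_le_add (mul_le_mul_of_nonneg_left (hpge φ hφ x) ha)
      (mul_le_mul_of_nonneg_left (hpge φ hφ y) hb)
  have hlip : LipschitzWith K.toNNReal p := by
    apply LipschitzWith.of_le_add_mul
    intro x y
    refine hple _ _ fun φ hφ => ?_
    have := (le_abs_self _).trans (hle φ hφ (x - y))
    rw [map_sub] at this
    rw [dist_eq_norm, Real.coe_toNNReal _ hK0]
    linarith [hpge φ hφ y]
  obtain ⟨G, -, -, hGd, hG⟩ := hX Set.univ p Set.univ_nonempty isOpen_univ convex_univ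
    hlip.continuous.continuousOn hconv
  have : Nonempty (Set.univ : Set X) := ⟨⟨0, trivial⟩⟩
  obtain ⟨⟨x, hxu⟩, hxG⟩ := hGd.nonempty
  obtain ⟨L, hL⟩ := hG x hxG
  obtain ⟨δ, hδ, hL⟩ := hL (Metric.closedBall 0 1) (NormedSpace.isVonNBounded_closedBall ℝ X 1)
    (ε / 4) (by positivity)
  obtain ⟨t, ht0, htδ⟩ := exists_between hδ
  refine ⟨x, p x - t * (ε / 4), ?_, ?_⟩
  · have : p x - t * (ε / 4) < p x := by
      have : 0 < t * (ε / 4) := by positivity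
      linarith
    obtain ⟨φ, hφ⟩ := exists_lt_of_lt_ciSup this
    exact ⟨φ.1, φ.2, hφ⟩
  have key : ∀ ψ ∈ S, p x - t * (ε / 4) < ψ x → ‖ψ - L‖ ≤ ε / 2 := by
    intro ψ hψ hlt
    have := norm_le_of_ball_le (φ := ψ - L) (r := 1) (C := ε / 2) one_pos (by
      intro h hh
      have a1 := hL t (by rwa [abs_of_pos ht0]) (by rwa [abs_of_pos ht0]) h (by simpa using hh)
      have a2 := (abs_lt.1 a1).2
      have a3 : p (x + t • h) - p x < t * (L h + ε / 4) := by
        rw [sub_lt_iff_lt_add, div_lt_iff₀ ht0] at a2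
        linarith
      have a4 := hpge ψ hψ (x + t • h)
      rw [map_add, map_smul, smul_eq_mul] at a4
      have a8 : t * (ψ h - L h) ≤ t * (ε / 2) := by linarith
      exact le_of_mul_le_mul_left a8 ht0)
    simpa using this
  intro φ hφ ψ hψ h1 h2
  have b1 := key φ hφ h1
  have b2 := key ψ hψ h2
  calc ‖φ - ψ‖ = ‖(φ - L) - (ψ - L)‖ := by congr 1; abel
    _ ≤ ‖φ - L‖ + ‖ψ - L‖ := norm_sub_le _ _
    _ ≤ ε := by linarith

lemma exists_coord {D : Set P} {f : P → ℝ} (hD : IsOpen D)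
    (hf : ContinuousOn f D) (hfc : ConvexOn ℝ D f)
    {X : Type*} [NormedAddCommGroup X] [NormedSpace ℝ X] (hX : IsAsplund X) (j : X →L[ℝ] P)
    {U : Set P} (hU : IsOpen U) (hUne : U.Nonempty) (hUD : U ⊆ D) {ε : ℝ} (hε : 0 < ε) :
    ∃ V : Set P, IsOpen V ∧ V.Nonempty ∧ V ⊆ U ∧ ∀ v ∈ V, ∀ w ∈ V, ∀ φ ψ : P →L[ℝ] ℝ,
      SubgAt D f v φ → SubgAt D f w ψ → ‖φ.comp j - ψ.comp j‖ ≤ ε := by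
  obtain ⟨x, hxU⟩ := hUne
  obtain ⟨K, hK0, V, hVo, hxV, hVD, hK⟩ := subg_locBdd hD hf (hUD hxU)
  set S : Set (X →L[ℝ] ℝ) := {χ | ∃ v ∈ U ∩ V, ∃ φ, SubgAt D f v φ ∧ χ = φ.comp j} with hS
  have hSne : S.Nonempty := by
    obtain ⟨φ, hφ⟩ := exists_subgAt hD hf hfc (hUD hxU)
    exact ⟨_, x, ⟨hxU, hxV⟩, φ, hφ, rfl⟩
  obtain ⟨z, c, ⟨χ, ⟨u, hu, φ, hφ, rfl⟩, hcz⟩, hsl⟩ := exists_slice hX hSne (K := K * ‖j‖) (by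
    rintro _ ⟨v, hv, φ, hφ, rfl⟩
    exact (φ.opNorm_comp_le j).trans
      (mul_le_mul_of_nonneg_right (hK v hv.2 φ hφ) (norm_nonneg _))) hε
  -- choose a small step `s`
  have hUV : IsOpen (U ∩ V) := hU.inter hVo
  have hcont : Tendsto (fun s : ℝ => u + s • j z) (𝓝[>] 0) (𝓝 u) := by
    have : Continuous (fun s : ℝ => u + s • j z) := by fun_prop
    have h := this.tendsto 0
    simp only [zero_smul, add_zero] at h
    exact h.mono_left nhdsWithin_le_nhds
  obtain ⟨s, hsm, hs0⟩ := ((hcont.eventually (hUV.mem_nhds hu)).and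
    self_mem_nhdsWithin).exists
  have hs0 : 0 < s := hs0
  set a := u + s • j z with ha
  have haD : a ∈ D := hUD hsm.1
  have huD : u ∈ D := hUD hu.1
  have hsub : a - s • j z = u := by rw [ha]; abel
  have hca : ContinuousAt f a := hf.continuousAt (hD.mem_nhds haD)
  have hcu : ContinuousAt f (a - s • j z) := by
    rw [hsub]; exact hf.continuousAt (hD.mem_nhds huD)
  have hsh : ContinuousAt (fun v : P => v - s • j z) a := by fun_prop
  have hcu2 : ContinuousAt (fun v : P => f (v - s • j z)) a :=
    ContinuousAt.comp (f := fun v : P => v - s • j z) hcu hsh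
  have hgt : s * c < f a - f (a - s • j z) := by
    have := hφ a haD
    rw [hsub]
    rw [ha, add_sub_cancel_left, map_smul, smul_eq_mul] at this
    have h2 : s * c < s * φ (j z) := mul_lt_mul_of_pos_left hcz hs0
    rw [ha]
    linarith
  have hev : ∀ᶠ v in 𝓝 a, s * c < f v - f (v - s • j z) :=
    continuousAt_const.eventually_lt (hca.sub hcu2) hgt
  have hev2 : ∀ᶠ v in 𝓝 a, v - s • j z ∈ D :=
    hsh.eventually (hD.mem_nhds (by simpa only [hsub] using huD))
  obtain ⟨W, hW, hWo, haW⟩ := eventually_nhds_iff.1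
    ((hev.and hev2).and (hUV.mem_nhds hsm))
  have key : ∀ v ∈ W, ∀ ψ : P →L[ℝ] ℝ, SubgAt D f v ψ → c < (ψ.comp j) z := by
    intro v hv ψ hψ
    obtain ⟨⟨h1, h2⟩, h3⟩ := hW v hv
    have h4 := hψ _ h2
    rw [sub_sub_cancel_left, map_neg, map_smul, smul_eq_mul] at h4
    have : s * c < s * ψ (j z) := by linarith
    exact lt_of_mul_lt_mul_left this hs0.le
  refine ⟨W, hWo, ⟨a, haW⟩, fun v hv => (hW v hv).2.1, ?_⟩
  intro v hv w hw φ ψ hφ hψ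
  exact hsl _ ⟨v, (hW v hv).2, φ, hφ, rfl⟩ _ ⟨w, (hW w hw).2, ψ, hψ, rfl⟩
    (key v hv φ hφ) (key w hw ψ hψ)

lemma exists_coords {D : Set P} {f : P → ℝ} (hD : IsOpen D)
    (hf : ContinuousOn f D) (hfc : ConvexOn ℝ D f) {ι : Type*}
    {X : ι → Type*} [∀ i, NormedAddCommGroup (X i)] [∀ i, NormedSpace ℝ (X i)]
    (hX : ∀ i, IsAsplund (X i)) (j : ∀ i, X i →L[ℝ] P) (s : Finset ι)
    {U : Set P} (hU : IsOpen U) (hUne : U.Nonempty) (hUD : U ⊆ D) {ε : ℝ} (hε : 0 < ε) :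
    ∃ V : Set P, IsOpen V ∧ V.Nonempty ∧ V ⊆ U ∧ ∀ v ∈ V, ∀ w ∈ V, ∀ φ ψ : P →L[ℝ] ℝ,
      SubgAt D f v φ → SubgAt D f w ψ → ∀ i ∈ s, ‖φ.comp (j i) - ψ.comp (j i)‖ ≤ ε := by
  classical
  induction s using Finset.induction_on with
  | empty => exact ⟨U, hU, hUne, le_rfl, by simp⟩
  | insert i s his ih =>
    obtain ⟨V, hVo, hVne, hVU, hV⟩ := ih
    obtain ⟨W, hWo, hWne, hWV, hW⟩ := exists_coord hD hf hfc (hX i) (j i) hVo hVne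
      (hVU.trans hUD) hε
    refine ⟨W, hWo, hWne, hWV.trans hVU, fun v hv w hw φ ψ hφ hψ k hk => ?_⟩
    rcases Finset.mem_insert.1 hk with rfl | hk
    · exact hW v hv w hw φ ψ hφ hψ
    · exact hV v (hWV hv) w (hWV hw) φ ψ hφ hψ k hk

lemma isAsplund_pi {ι : Type*} [Fintype ι]
    {X : ι → Type*} [∀ i, NormedAddCommGroup (X i)] [∀ i, NormedSpace ℝ (X i)]
    [∀ i, CompleteSpace (X i)] (hX : ∀ i, IsAsplund (X i)) : IsAsplund (∀ i, X i) := by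
  classical
  intro D f hne hD hDc hf hfc
  have hdense : ∀ ε : ℝ, 0 < ε → Dense (Subtype.val ⁻¹' oscSet D f ε : Set D) := by
    intro ε hε
    rw [dense_iff_inter_open]
    rintro O hO ⟨⟨x, hxD⟩, hxO⟩
    obtain ⟨O', hO', rfl⟩ := isOpen_induced_iff.1 hO
    obtain ⟨V, hVo, ⟨v, hv⟩, hVU, hV⟩ := exists_coords hD hf hfc hX
      (fun i => ContinuousLinearMap.single ℝ X i) Finset.univ (hO'.inter hD) ⟨x, hxO, hxD⟩
      Set.inter_subset_right (ε := ε / (Fintype.card ι + 1)) (by positivity)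
    refine ⟨⟨v, (hVU hv).2⟩, (hVU hv).1, V, hVo, hv, fun y hy => (hVU hy).2, ?_⟩
    intro a ha b hb φ ψ hφ hψ
    have h := hV a ha b hb φ ψ hφ hψ
    refine ContinuousLinearMap.opNorm_le_bound _ hε.le fun y => ?_
    have hy : y = ∑ i, ContinuousLinearMap.single ℝ X i (y i) := by
      simp [Finset.univ_sum_single]
    calc ‖(φ - ψ) y‖ = ‖∑ i, (φ.comp (ContinuousLinearMap.single ℝ X i) -
          ψ.comp (ContinuousLinearMap.single ℝ X i)) (y i)‖ := by
            conv_lhs => rw [hy, map_sum]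
            rfl
      _ ≤ ∑ i, ‖(φ.comp (ContinuousLinearMap.single ℝ X i) -
          ψ.comp (ContinuousLinearMap.single ℝ X i)) (y i)‖ := norm_sum_le _ _
      _ ≤ ∑ i : ι, ε / (Fintype.card ι + 1) * ‖y‖ := by
            refine Finset.sum_le_sum fun i hi => ?_
            refine (ContinuousLinearMap.le_opNorm _ _).trans ?_
            exact mul_le_mul (h i hi) (norm_le_pi_norm y i) (norm_nonneg _) (by positivity)
      _ = (Fintype.card ι / (Fintype.card ι + 1)) * (ε * ‖y‖) := by
            simp; ring
      _ ≤ 1 * (ε * ‖y‖) := by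
            gcongr
            rw [div_le_one (by positivity)]
            linarith
      _ = ε * ‖y‖ := one_mul _
  have : BaireSpace D := hD.baireSpace
  have hopen : ∀ n : ℕ, IsOpen (Subtype.val ⁻¹' oscSet D f (1 / ((n : ℝ) + 1)) : Set D) :=
    fun n => (isOpen_oscSet D f _).preimage continuous_subtype_val
  have hpre : (Subtype.val ⁻¹' (D ∩ ⋂ n : ℕ, oscSet D f (1 / ((n : ℝ) + 1))) : Set D) =
      ⋂ n : ℕ, (Subtype.val ⁻¹' oscSet D f (1 / ((n : ℝ) + 1)) : Set D) := by
    ext x; simp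
  refine ⟨D ∩ ⋂ n : ℕ, oscSet D f (1 / ((n : ℝ) + 1)), Set.inter_subset_left, ?_, ?_, ?_⟩
  · rw [hpre]
    exact IsGδ.iInter_of_isOpen hopen
  · rw [hpre]
    exact dense_iInter_of_isOpen hopen fun n => hdense _ (by positivity)
  · rintro x ⟨hxD, hx⟩
    refine frechet_of_mem_oscSet hD hf hfc hxD fun ε hε => ?_
    obtain ⟨n, hn⟩ := exists_nat_one_div_lt hε
    obtain ⟨V, h1, h2, h3, h4⟩ := Set.mem_iInter.1 hx n
    exact ⟨V, h1, h2, h3, fun v hv w hw φ ψ hφ hψ => (h4 v hv w hw φ ψ hφ hψ).trans hn.le⟩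

/-- In a normed space density of the Fréchet differentiability points suffices. -/
lemma exists_gdelta_of_dense {D : Set P} {f : P → ℝ} (hD : IsOpen D)
    (hf : ContinuousOn f D) (hfc : ConvexOn ℝ D f)
    (hd : Dense (Subtype.val ⁻¹' {x | FrechetDiffAt f x} : Set D)) :
    ∃ G : Set P, G ⊆ D ∧ IsGδ (Subtype.val ⁻¹' G : Set D) ∧
      Dense (Subtype.val ⁻¹' G : Set D) ∧ ∀ x ∈ G, FrechetDiffAt f x := by
  have hopen : ∀ n : ℕ, IsOpen (Subtype.val ⁻¹' oscSet D f (1 / ((n : ℝ) + 1)) : Set D) :=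
    fun n => (isOpen_oscSet D f _).preimage continuous_subtype_val
  have hpre : (Subtype.val ⁻¹' (D ∩ ⋂ n : ℕ, oscSet D f (1 / ((n : ℝ) + 1))) : Set D) =
      ⋂ n : ℕ, (Subtype.val ⁻¹' oscSet D f (1 / ((n : ℝ) + 1)) : Set D) := by
    ext x; simp
  refine ⟨D ∩ ⋂ n : ℕ, oscSet D f (1 / ((n : ℝ) + 1)), Set.inter_subset_left, ?_, ?_, ?_⟩
  · rw [hpre]
    exact IsGδ.iInter_of_isOpen hopen
  · refine hd.mono fun x hx => ⟨x.2, Set.mem_iInter.2 fun n => ?_⟩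
    exact mem_oscSet_of_frechet hD hf x.2 hx (by positivity)
  · rintro x ⟨hxD, hx⟩
    refine frechet_of_mem_oscSet hD hf hfc hxD fun ε hε => ?_
    obtain ⟨n, hn⟩ := exists_nat_one_div_lt hε
    obtain ⟨V, h1, h2, h3, h4⟩ := Set.mem_iInter.1 hx n
    exact ⟨V, h1, h2, h3, fun v hv w hw φ ψ hφ hψ => (h4 v hv w hw φ ψ hφ hψ).trans hn.le⟩

end Aux

section Reduction

lemma convex_add_submodule {Y : Type*} [AddCommGroup Y] [Module ℝ Y] [TopologicalSpace Y]
    [IsTopologicalAddGroup Y] [ContinuousSMul ℝ Y] {D : Set Y} {f : Y → ℝ}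
    (hD : IsOpen D) (hfc : ConvexOn ℝ D f) (N : Submodule ℝ Y) {x₀ : Y} {M : ℝ}
    (hN : ∀ n ∈ N, x₀ + n ∈ D ∧ f (x₀ + n) ≤ M) {z : Y} (hz : z ∈ D) {n : Y} (hn : n ∈ N) :
    z + n ∈ D ∧ f (z + n) = f z := by
  -- boundedness along `N`
  have bdd : ∀ z ∈ D, ∃ C : ℝ, ∀ n ∈ N, z + n ∈ D ∧ f (z + n) ≤ C := by
    intro z hz
    have hcont : Tendsto (fun s : ℝ => z + s • (z - x₀)) (𝓝[>] 0) (𝓝 z) := by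
      have : Continuous (fun s : ℝ => z + s • (z - x₀)) := by fun_prop
      have h := this.tendsto 0
      simp only [zero_smul, add_zero] at h
      exact h.mono_left nhdsWithin_le_nhds
    obtain ⟨e, hem, he0⟩ := ((hcont.eventually (hD.mem_nhds hz)).and
      self_mem_nhdsWithin).exists
    have he0 : 0 < e := he0
    have hem : z + e • (z - x₀) ∈ D := hem
    refine ⟨(1 / (1 + e)) * f (z + e • (z - x₀)) + (e / (1 + e)) * M, fun n hn => ?_⟩
    obtain ⟨h1, h2⟩ := hN (((1 + e) / e) • n) (N.smul_mem _ hn)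
    have hsum : (1 / (1 + e)) + (e / (1 + e)) = 1 := by field_simp
    have ha : 0 ≤ 1 / (1 + e) := by positivity
    have hb : 0 ≤ e / (1 + e) := by positivity
    have heq : (1 / (1 + e)) • (z + e • (z - x₀)) + (e / (1 + e)) • (x₀ + ((1 + e) / e) • n)
        = z + n := by
      match_scalars <;> field_simp <;> ring
    have h3 := hfc.1 hem h1 ha hb hsum
    have h4 := hfc.2 hem h1 ha hb hsum
    rw [heq] at h3 h4
    simp only [smul_eq_mul] at h4
    refine ⟨h3, h4.trans ?_⟩
    gcongr
  have hle : ∀ z ∈ D, ∀ n ∈ N, f (z + n) ≤ f z := by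
    intro z hz n hn
    obtain ⟨C, hC⟩ := bdd z hz
    by_contra! hlt
    set d := f (z + n) - f z with hd
    have hd0 : 0 < d := by linarith
    obtain ⟨t, ht1, ht2⟩ : ∃ t : ℝ, 1 ≤ t ∧ C - f z < d * t := by
      refine ⟨max 1 ((C - f z) / d + 1), le_max_left _ _, ?_⟩
      have : (C - f z) / d < max 1 ((C - f z) / d + 1) :=
        (lt_add_one _).trans_le (le_max_right _ _)
      rw [div_lt_iff₀ hd0] at this
      linarith
    have ht0 : 0 < t := by linarith
    obtain ⟨h1, h2⟩ := hC (t • n) (N.smul_mem _ hn)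
    have hb : 0 ≤ 1 / t := by positivity
    have ha : 0 ≤ 1 - 1 / t := by
      rw [sub_nonneg, div_le_one ht0]; exact ht1
    have heq : (1 - 1 / t) • z + (1 / t) • (z + t • n) = z + n := by
      match_scalars <;> field_simp <;> ring
    have h4 := hfc.2 hz h1 ha hb (by ring)
    rw [heq] at h4
    simp only [smul_eq_mul] at h4
    have h5 : t * f (z + n) ≤ (t - 1) * f z + f (z + t • n) := by
      calc t * f (z + n) ≤ t * ((1 - 1 / t) * f z + 1 / t * f (z + t • n)) := by gcongr
        _ = (t - 1) * f z + f (z + t • n) := by field_simp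
    have h6 : d * t = t * f (z + n) - t * f z := by rw [hd]; ring
    linarith
  obtain ⟨C, hC⟩ := bdd z hz
  have hzn := (hC n hn).1
  refine ⟨hzn, le_antisymm (hle z hz n hn) ?_⟩
  have := hle _ hzn (-n) (N.neg_mem hn)
  rwa [add_neg_cancel_right] at this

lemma asplund_transfer {Y P : Type*} [AddCommGroup Y] [Module ℝ Y] [TopologicalSpace Y]
    [IsTopologicalAddGroup Y] [NormedAddCommGroup P] [NormedSpace ℝ P] (hP : IsAsplund P)
    (π : Y →L[ℝ] P) (s : P →L[ℝ] Y) (hπs : ∀ p, π (s p) = p)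
    {D : Set Y} {f : Y → ℝ} (hne : D.Nonempty) (hD : IsOpen D)
    (hf : ContinuousOn f D) (hfc : ConvexOn ℝ D f)
    (hDs : ∀ z, z ∈ D ↔ s (π z) ∈ D) (hfs : ∀ z ∈ D, f z = f (s (π z))) :
    ∃ G : Set Y, G ⊆ D ∧ IsGδ (Subtype.val ⁻¹' G : Set D) ∧
      Dense (Subtype.val ⁻¹' G : Set D) ∧ ∀ x ∈ G, FrechetDiffAt f x := by
  have hD' : IsOpen (s ⁻¹' D) := hD.preimage s.continuous
  have hconv' : ConvexOn ℝ (s ⁻¹' D) (f ∘ s) := hfc.comp_linearMap s.toLinearMap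
  obtain ⟨x₀, hx₀⟩ := hne
  obtain ⟨G, hGD, hGδ, hGd, hGF⟩ := hP (s ⁻¹' D) (f ∘ s) ⟨π x₀, (hDs x₀).1 hx₀⟩ hD'
    hconv'.1 (hf.comp s.continuous.continuousOn (fun p hp => hp)) hconv'
  refine ⟨π ⁻¹' G, fun z hz => (hDs z).2 (hGD hz), ?_, ?_, ?_⟩
  · let q : D → (s ⁻¹' D : Set P) := fun z => ⟨π z.1, (hDs z.1).1 z.2⟩
    have hq : Continuous q := by
      apply Continuous.subtype_mk
      exact π.continuous.comp continuous_subtype_val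
    have := IsGδ.preimage hq hGδ
    exact this
  · rw [dense_iff_inter_open]
    rintro O hO ⟨⟨z, hzD⟩, hzO⟩
    obtain ⟨O', hO', rfl⟩ := isOpen_induced_iff.1 hO
    have hzO : z ∈ O' := hzO
    have hc : Continuous (fun p : P => z + s (p - π z)) := by
      have := s.continuous
      fun_prop
    have hO2 : IsOpen ((fun p : P => z + s (p - π z)) ⁻¹' O') := hO'.preimage hc
    obtain ⟨⟨p, hpD⟩, hpO, hpG⟩ := dense_iff_inter_open.1 hGd _
      (hO2.preimage (continuous_subtype_val (p := (· ∈ s ⁻¹' D))))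
      ⟨⟨π z, (hDs z).1 hzD⟩, by simpa using hzO⟩
    have hπ : π (z + s (p - π z)) = p := by rw [map_add, hπs]; abel
    refine ⟨⟨z + s (p - π z), (hDs _).2 ?_⟩, hpO, ?_⟩
    · rw [hπ]; exact hpD
    · change π (z + s (p - π z)) ∈ G
      rw [hπ]; exact hpG
  · intro x hx
    obtain ⟨L, hL⟩ := hGF (π x) hx
    have hxD : x ∈ D := (hDs x).2 (hGD hx)
    refine ⟨L.comp π, fun B hB ε hε => ?_⟩
    have hB' : IsVonNBounded ℝ (π '' B) := hB.image π
    obtain ⟨δ, hδ, hLδ⟩ := hL (π '' B) hB' ε hε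
    obtain ⟨R, hR⟩ := (NormedSpace.isVonNBounded_iff ℝ |>.1 hB').exists_norm_le
    obtain ⟨R', hR'0, hRR'⟩ : ∃ R' : ℝ, 0 < R' ∧ R ≤ R' :=
      ⟨max R 1, by positivity, le_max_left _ _⟩
    obtain ⟨r, hr, hball⟩ := Metric.isOpen_iff.1 hD' (π x) (hGD hx)
    refine ⟨min δ (r / R'), lt_min hδ (by positivity), fun t ht0 ht y hy => ?_⟩
    have h1 := hLδ t ht0 (ht.trans_le (min_le_left _ _)) (π y) ⟨y, hy, rfl⟩
    have ht2 := ht.trans_le (min_le_right _ _)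
    have hyR : ‖π y‖ ≤ R' := (hR _ ⟨y, hy, rfl⟩).trans hRR'
    have hmem : π x + t • π y ∈ s ⁻¹' D := hball (by
      rw [Metric.mem_ball, dist_eq_norm, add_sub_cancel_left, norm_smul, Real.norm_eq_abs]
      rw [lt_div_iff₀ hR'0] at ht2
      nlinarith)
    have hπ : π (x + t • y) = π x + t • π y := by rw [map_add, map_smul]
    have hxy : x + t • y ∈ D := (hDs _).2 (by rw [hπ]; exact hmem)
    rw [hfs _ hxy, hfs x hxD, hπ]
    exact h1

lemma asplund_factor {Y P : Type*} [AddCommGroup Y] [Module ℝ Y] [TopologicalSpace Y]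
    [NormedAddCommGroup P] [NormedSpace ℝ P] (hY : IsAsplund Y)
    (π : Y →L[ℝ] P) (s : P →L[ℝ] Y) (hπs : ∀ p, π (s p) = p) : IsAsplund P := by
  intro D f hne hD hDc hf hfc
  apply exists_gdelta_of_dense hD hf hfc
  have hconv' : ConvexOn ℝ (π ⁻¹' D) (f ∘ π) := hfc.comp_linearMap π.toLinearMap
  obtain ⟨p₀, hp₀⟩ := hne
  obtain ⟨G, hGD, -, hGd, hGF⟩ := hY (π ⁻¹' D) (f ∘ π)
    ⟨s p₀, by rw [Set.mem_preimage, hπs]; exact hp₀⟩ (hD.preimage π.continuous)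
    hconv'.1 (hf.comp π.continuous.continuousOn (fun p hp => hp)) hconv'
  rw [dense_iff_inter_open]
  rintro O hO ⟨⟨z, hzD⟩, hzO⟩
  obtain ⟨O', hO', rfl⟩ := isOpen_induced_iff.1 hO
  have hzO : z ∈ O' := hzO
  obtain ⟨⟨y, hyD⟩, hyO, hyG⟩ := dense_iff_inter_open.1 hGd _
    ((hO'.preimage π.continuous).preimage (continuous_subtype_val (p := (· ∈ π ⁻¹' D))))
    ⟨⟨s z, by rw [Set.mem_preimage, hπs]; exact hzD⟩, by
      rw [Set.mem_preimage, Set.mem_preimage, hπs]; exact hzO⟩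
  refine ⟨⟨π y, hyD⟩, hyO, ?_⟩
  obtain ⟨L, hL⟩ := hGF y hyG
  refine ⟨L.comp s, fun B hB ε hε => ?_⟩
  obtain ⟨δ, hδ, hLδ⟩ := hL (s '' B) (hB.image s) ε hε
  refine ⟨δ, hδ, fun t ht0 ht x hx => ?_⟩
  have h1 := hLδ t ht0 ht (s x) ⟨x, hx, rfl⟩
  simpa [hπs] using h1

end Reduction

/-- The Σ-product (with base point `0`) of an arbitrary family of real Banach spaces is an
Asplund locally convex space if and only if every factor is an Asplund space. -/
theorem isAsplund_sigmaProduct_banach_iff {A : Type*} (E : A → Type*)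
    [∀ α, NormedAddCommGroup (E α)] [∀ α, NormedSpace ℝ (E α)] [∀ α, CompleteSpace (E α)] :
    IsAsplund (sigmaProduct E) ↔ ∀ α, IsAsplund (E α) := by
  classical
  constructor
  · intro hY α
    refine asplund_factor hY
      ((ContinuousLinearMap.proj α).comp (sigmaProduct E).subtypeL)
      ((ContinuousLinearMap.single ℝ E α).codRestrict (sigmaProduct E) fun x => ?_) fun p => ?_
    · refine (Set.countable_singleton α).mono fun β hβ => ?_
      by_contra hne
      exact hβ (by simp [Pi.single_eq_of_ne hne])
    · exact Pi.single_eq_same (M := E) α p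
  · intro hE D f hne hD hDc hf hfc
    obtain ⟨x₀, hx₀⟩ := hne
    -- a neighbourhood of `x₀` on which `f` is bounded above
    have hopen : IsOpen (D ∩ f ⁻¹' Set.Iio (f x₀ + 1)) := hf.isOpen_inter_preimage hD isOpen_Iio
    obtain ⟨U, hU, hUeq⟩ := isOpen_induced_iff.1 hopen
    have hx₀U : (x₀ : ∀ α, E α) ∈ U := by
      have : x₀ ∈ Subtype.val ⁻¹' U := by
        rw [hUeq]; exact ⟨hx₀, by simp⟩
      exact this
    obtain ⟨F, u, hu, hFU⟩ := isOpen_pi_iff.1 hU _ hx₀U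
    let π : sigmaProduct E →L[ℝ] (∀ i : F, E i.1) := ContinuousLinearMap.pi fun i =>
      (ContinuousLinearMap.proj i.1).comp (sigmaProduct E).subtypeL
    let s₀ : (∀ i : F, E i.1) →L[ℝ] (∀ α, E α) := ContinuousLinearMap.pi fun α =>
      if h : α ∈ F then ContinuousLinearMap.proj (R := ℝ) (φ := fun i : F => E i.1) ⟨α, h⟩ else 0
    have hs₀ : ∀ p (α) (h : α ∈ F), s₀ p α = p ⟨α, h⟩ := fun p α h => by
      simp [s₀, h]
    have hs₀' : ∀ p (α) (h : α ∉ F), s₀ p α = 0 := fun p α h => by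
      simp [s₀, h]
    let s : (∀ i : F, E i.1) →L[ℝ] sigmaProduct E := s₀.codRestrict (sigmaProduct E) fun p => by
      refine F.countable_toSet.mono fun β hβ => ?_
      by_contra hne
      exact hβ (hs₀' p β hne)
    have hπs : ∀ p, π (s p) = p := fun p => by
      ext i
      exact hs₀ p i.1 i.2
    have hN : ∀ n ∈ LinearMap.ker π.toLinearMap, x₀ + n ∈ D ∧ f (x₀ + n) ≤ f x₀ + 1 := by
      intro n hn
      have hn : π n = 0 := hn
      have hmem : x₀ + n ∈ Subtype.val ⁻¹' U := by
        apply hFU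
        intro α hα
        have h0 : (n : ∀ α, E α) α = 0 := congrFun hn ⟨α, hα⟩
        have : ((x₀ + n : sigmaProduct E) : ∀ α, E α) α = (x₀ : ∀ α, E α) α := by
          simp [h0]
        rw [this]
        exact (hu α hα).2
      rw [hUeq] at hmem
      exact ⟨hmem.1, le_of_lt hmem.2⟩
    have hker : ∀ z, s (π z) - z ∈ LinearMap.ker π.toLinearMap := fun z => by
      change π (s (π z) - z) = 0
      rw [map_sub, hπs, sub_self]
    have h1 : ∀ z ∈ D, s (π z) ∈ D ∧ f (s (π z)) = f z := fun z hz => by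
      have := convex_add_submodule hD hfc _ hN hz (hker z)
      rwa [add_sub_cancel] at this
    refine asplund_transfer (isAsplund_pi fun i : F => hE i.1) π s hπs ⟨x₀, hx₀⟩ hD hf hfc
      (fun z => ⟨fun hz => (h1 z hz).1, fun hz => ?_⟩) fun z hz => (h1 z hz).2.symm
    have := convex_add_submodule hD hfc _ hN hz (Submodule.neg_mem _ (hker z))
    rw [neg_sub, add_sub_cancel] at this
    exact this.1
end
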